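/- There exists an (inconsistent) classical CSP P such that some optimal solution of P is not a Nash equilibrium of the associated local game L(P); hence the conclusion of the theorem for strictly monotonic combination fails for classical CSPs. (For instance, the CSP with variables x, y, z, each with domain {a,b}, constraint C_{xy} allowing only aa and constraint C_{yz} allowing only ba: every assignment, in particular baa, has preference 0 and is thus optimal, but baa is not a Nash equilibrium of L(P).) -/

import Mathlib

/-- An (abstract) soft constraint satisfaction problem (SCSP) over a linearly
ordered commutative monoid `M` (written multiplicatively), with variable set `V`.
Each constraint `c` has a scope `con c ⊆ V` and a valuation `val c`, canonically
extended to full assignments, which only depends on the variables in the scope. -/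
structure SCSP (V : Type) (M : Type) [LinearOrder M] [CommMonoid M] where
  /-- the (nonempty) domain of each variable -/
  D : V → Type
  Dne : ∀ v, Nonempty (D v)
  /-- index type for the (finitely many) constraints -/
  ι : Type
  fin : Fintype ι
  /-- the scope of each constraint -/
  con : ι → Finset V
  /-- the valuation of each constraint, canonically extended to full assignments -/
  val : ι → ((v : V) → D v) → M
  /-- the valuation only depends on the variables in the scope -/
  val_scope : ∀ c s s', (∀ v ∈ con c, s v = s' v) → val c s = val c s'

namespace SCSP

variable {V M : Type} [LinearOrder M] [CommMonoid M] (P : SCSP V M)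

/-- The preference of a full assignment: the combination of the valuations of
all constraints. -/
def pref (s : (v : V) → P.D v) : M :=
  letI := P.fin
  ∏ c : P.ι, P.val c s

/-- The payoff of player `v` in the local game `L(P)`: the combination of the
valuations of the constraints whose scope contains `v`. -/
noncomputable def payoff (v : V) (s : (w : V) → P.D w) : M :=
  letI := P.fin
  letI := Classical.decPred (fun c : P.ι => v ∈ P.con c)
  ∏ c ∈ Finset.univ.filter (fun c => v ∈ P.con c), P.val c s

/-- A full assignment is optimal if no full assignment has a strictly higher
preference. -/
def Optimal (s : (v : V) → P.D v) : Prop :=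
  ¬ ∃ s' : (v : V) → P.D v, P.pref s < P.pref s'

/-- A full assignment is a Nash equilibrium of the local game `L(P)` if no
player `v` can strictly increase its payoff by unilaterally changing its value. -/
def NashLocal [DecidableEq V] (s : (v : V) → P.D v) : Prop :=
  ∀ (v : V) (d : P.D v), P.payoff v (Function.update s v d) ≤ P.payoff v s

end SCSP

/-- The classical CSP with variables `0, 1, 2`, each with domain `Bool`, one constraint on
`{0, 1}` allowing only `true, true`, and one on `{1, 2}` allowing only `false, true`. -/
abbrev inconsistentCSP : SCSP (Fin 3) (Fin 2) where
  D := fun _ => Bool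
  Dne := fun _ => ⟨true⟩
  ι := Bool
  fin := inferInstance
  con := fun c => if c then {0, 1} else {1, 2}
  val := fun c s =>
    if c then (if s 0 = true ∧ s 1 = true then 1 else 0)
    else (if s 1 = false ∧ s 2 = true then 1 else 0)
  val_scope := by
    intro c s s' h
    cases c <;> simp_all

theorem inconsistentCSP_pref (s : Fin 3 → Bool) :
    inconsistentCSP.pref s = 0 := by
  change (∏ c : Bool, inconsistentCSP.val c s) = 0
  rw [Fintype.prod_bool]
  change (if s 0 = true ∧ s 1 = true then (1 : Fin 2) else 0) *
    (if s 1 = false ∧ s 2 = true then 1 else 0) = 0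
  cases s 1 <;> simp

theorem inconsistentCSP_payoff_zero (s : Fin 3 → Bool) :
    inconsistentCSP.payoff 0 s = if s 0 = true ∧ s 1 = true then 1 else 0 := by
  have hfilter (p : DecidablePred fun c : Bool => (0 : Fin 3) ∈ inconsistentCSP.con c) :
      (Finset.univ : Finset Bool).filter (fun c => 0 ∈ inconsistentCSP.con c) = {true} := by
    ext c
    rw [Finset.mem_filter]
    cases c <;> simp
  unfold SCSP.payoff
  exact (congrArg (fun t : Finset Bool => ∏ c ∈ t, inconsistentCSP.val c s) (hfilter _)).trans
    (Finset.prod_singleton _ _)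

/-- There exists an (inconsistent) classical CSP `P` (an SCSP over `{0,1}`,
here `Fin 2` whose multiplication coincides with `min`, i.e. conjunction, with
the order `0 < 1`) such that some optimal solution of `P` is not a Nash
equilibrium of the associated local game `L(P)`; hence the conclusion of the
theorem for strictly monotonic combination fails for classical CSPs. -/
theorem exists_csp_optimal_not_nashLocal :
    ∃ (V : Type) (_ : DecidableEq V) (P : SCSP V (Fin 2)) (s : (v : V) → P.D v),
      (¬ ∃ t : (v : V) → P.D v, P.pref t = 1) ∧ P.Optimal s ∧ ¬ P.NashLocal s := by
  refine ⟨Fin 3, inferInstance, inconsistentCSP, ![false, true, true], ?_, ?_, ?_⟩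
  · rintro ⟨t, ht⟩
    exact zero_ne_one ((inconsistentCSP_pref t).symm.trans ht)
  · rintro ⟨t, ht⟩
    exact ht.ne ((inconsistentCSP_pref _).trans (inconsistentCSP_pref t).symm)
  · intro h
    have h0 := h 0 true
    rw [inconsistentCSP_payoff_zero, inconsistentCSP_payoff_zero] at h0
    revert h0
    decide
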